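/- Let k be a positive integer and let m, n be positive integers with d = gcd(m,n). Then Φ_k(mn)·Φ_k(d) = d^k·Φ_k(m)·Φ_k(n). -/

import Mathlib

/-- `Phi k n` is the number of `k`-tuples `(x_1,…,x_k) ∈ (ℤ/nℤ)^k`
with `gcd(x_1² + ⋯ + x_k², n) = 1`. -/
noncomputable def Phi (k n : ℕ) : ℕ :=
  Nat.card {x : Fin k → ZMod n // Nat.gcd (∑ i, (x i) ^ 2 : ZMod n).val n = 1}

theorem ZMod.coprime_val_iff_isUnit {n : ℕ} (hn : 0 < n) (a : ZMod n) :
    Nat.gcd a.val n = 1 ↔ IsUnit a := by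
  have : NeZero n := ⟨hn.ne'⟩
  conv_rhs => rw [← ZMod.natCast_zmod_val a]
  exact (ZMod.isUnit_iff_coprime a.val n).symm

theorem Phi_eq_card_isUnit (k : ℕ) {n : ℕ} (hn : 0 < n) :
    Phi k n = Nat.card {x : Fin k → ZMod n // IsUnit (∑ i, x i ^ 2)} := by
  simp only [Phi, ZMod.coprime_val_iff_isUnit hn]

theorem Phi_one (k : ℕ) : Phi k 1 = 1 := by
  rw [Phi_eq_card_isUnit k one_pos, Nat.card_eq_one_iff_unique]
  exact ⟨inferInstance, ⟨0, isUnit_of_subsingleton _⟩⟩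

theorem Phi_mul_of_coprime (k : ℕ) {m n : ℕ} (hm : 0 < m) (hn : 0 < n)
    (h : Nat.Coprime m n) : Phi k (m * n) = Phi k m * Phi k n := by
  rw [Phi_eq_card_isUnit k hm, Phi_eq_card_isUnit k hn,
    Phi_eq_card_isUnit k (Nat.mul_pos hm hn), ← Nat.card_prod]
  let e := ZMod.chineseRemainder h
  refine Nat.card_congr <| (Equiv.subtypeEquiv
    ((Equiv.piCongrRight fun _ => e.toEquiv).trans (Equiv.arrowProdEquivProdArrow _ _ _))
    (q := fun y => IsUnit (∑ i, y.1 i ^ 2) ∧ IsUnit (∑ i, y.2 i ^ 2)) fun x => ?_).trans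
    (Equiv.subtypeProdEquivProd (p := fun y : Fin k → ZMod m => IsUnit (∑ i, y i ^ 2))
      (q := fun y : Fin k → ZMod n => IsUnit (∑ i, y i ^ 2)))
  rw [← MulEquiv.isUnit_map e, Prod.isUnit_iff]
  simp [map_sum, Prod.fst_sum, Prod.snd_sum, Equiv.arrowProdEquivProdArrow]

/-- The fibres of a surjective homomorphism of finite groups all have the same size. -/
theorem AddMonoidHom.card_subtype_comp_mul_card {G H : Type*} [AddGroup G] [AddGroup H]
    [Finite G] [Finite H] (f : G →+ H) (hf : Function.Surjective f) (P : H → Prop) :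
    Nat.card {x // P (f x)} * Nat.card H = Nat.card G * Nat.card {y // P y} := by
  have key (Q : H → Prop) :
      Nat.card {x // Q (f x)} = Nat.card {y // Q y} * Nat.card f.ker := by
    rw [← Nat.card_prod, Nat.card_congr (Equiv.sigmaFiberEquiv
      (fun x : {x // Q (f x)} => (⟨f x, x.2⟩ : {y // Q y}))).symm]
    refine Nat.card_congr ((Equiv.sigmaCongrRight fun y => ?_).trans (Equiv.sigmaEquivProd _ _))
    refine Equiv.trans ?_ (AddMonoidHom.fiberEquivKerOfSurjective hf y.1)
    exact
      { toFun := fun x => ⟨x.1.1, congrArg Subtype.val x.2⟩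
        invFun := fun x => ⟨⟨x.1, by
          have hx : f x.1 = y.1 := x.2
          rw [hx]; exact y.2⟩, Subtype.ext x.2⟩
        left_inv := fun _ => rfl
        right_inv := fun _ => rfl }
  have hG := key fun _ => True
  rw [Nat.card_congr (Equiv.subtypeUnivEquiv fun _ => trivial),
    Nat.card_congr (Equiv.subtypeUnivEquiv fun _ => trivial)] at hG
  rw [key P, hG]
  ring

theorem Phi_prime_pow_mul (k : ℕ) {p e : ℕ} (hp : p.Prime) (he : 0 < e) :
    Phi k (p ^ e) * p ^ k = (p ^ e) ^ k * Phi k p := by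
  have : NeZero p := ⟨hp.ne_zero⟩
  have : NeZero (p ^ e) := ⟨(pow_pos hp.pos e).ne'⟩
  let r := ZMod.castHom (dvd_pow_self p he.ne') (ZMod p)
  let f : (Fin k → ZMod (p ^ e)) →+ (Fin k → ZMod p) := r.toAddMonoidHom.compLeft (Fin k)
  have hf : Function.Surjective f := (ZMod.ringHom_surjective r).comp_left
  have hr (a : ZMod (p ^ e)) : IsUnit (r a) ↔ IsUnit a := by
    rw [← ZMod.natCast_zmod_val a, map_natCast, ZMod.isUnit_iff_coprime, ZMod.isUnit_iff_coprime,
      Nat.coprime_pow_right_iff he]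
  have h := f.card_subtype_comp_mul_card hf fun y => IsUnit (∑ i, y i ^ 2)
  have hsum (x : Fin k → ZMod (p ^ e)) : ∑ i, f x i ^ 2 = r (∑ i, x i ^ 2) := by
    simp [f, map_sum]
  simp only [hsum, hr, Nat.card_fun, Nat.card_zmod, Nat.card_fin] at h
  rwa [Phi_eq_card_isUnit k hp.pos, Phi_eq_card_isUnit k (pow_pos hp.pos e)]

theorem Phi_eq_pow_mul_prod_primeFactors (k : ℕ) {n : ℕ} (hn : 0 < n) :
    (Phi k n : ℚ) = n ^ k * ∏ p ∈ n.primeFactors, (Phi k p / p ^ k : ℚ) := by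
  induction n using Nat.recOnPosPrimePosCoprime with
  | zero => exact absurd hn (lt_irrefl 0)
  | one => simp [Phi_one]
  | prime_pow p e hp he =>
    have hp0 : (p : ℚ) ≠ 0 := mod_cast hp.ne_zero
    rw [Nat.primeFactors_prime_pow he.ne' hp, Finset.prod_singleton, ← mul_div_assoc,
      eq_div_iff (pow_ne_zero k hp0)]
    exact_mod_cast Phi_prime_pow_mul k hp he
  | coprime a b ha hb hab iha ihb =>
    have ha0 : 0 < a := by omega
    have hb0 : 0 < b := by omega
    rw [Phi_mul_of_coprime k ha0 hb0 hab, hab.primeFactors_mul,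
      Finset.prod_union hab.disjoint_primeFactors, Nat.cast_mul, iha ha0, ihb hb0]
    push_cast
    ring

theorem Phi_gcd_mul (k : ℕ) (hk : 0 < k) (m n : ℕ) (hm : 0 < m) (hn : 0 < n)
    (d : ℕ) (hd : d = Nat.gcd m n) :
    Phi k (m * n) * Phi k d = d ^ k * Phi k m * Phi k n := by
  subst hd
  have h := Nat.prod_primeFactors_gcd_mul_prod_primeFactors_mul m n
    fun p => (Phi k p / p ^ k : ℚ)
  rw [← Nat.cast_inj (R := ℚ)]
  push_cast
  rw [Phi_eq_pow_mul_prod_primeFactors k (Nat.mul_pos hm hn),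
    Phi_eq_pow_mul_prod_primeFactors k (Nat.gcd_pos_of_pos_left n hm),
    Phi_eq_pow_mul_prod_primeFactors k hm, Phi_eq_pow_mul_prod_primeFactors k hn]
  push_cast
  linear_combination ((m : ℚ) * n) ^ k * (m.gcd n : ℚ) ^ k * h
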